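/- Klainerman–Sobolev-type bound in (s,ρ) coordinates, 1D×sphere model: for a smooth function w on a region where t ≈ τ and |x| ≈ R with 1 ≤ R ≤ τ/4, one has ‖w‖_{L^∞(C^R_τ)} ≤ C ( (τR³)^{-1/2} ‖Z^{≤3} w‖_{L²L²(C̃^R_τ)} + (τ^{1/2} R)^{-1} ‖Z^{≤3}w‖^{1/2}_{L²L²(C̃^R_τ)} ‖∂_r Z^{≤3} w‖^{1/2}_{L²L²(C̃^R_τ)} ), where Z^{≤3} denotes products of at most 3 vector fields from {∂_t, ∂_x, Ω, S}. -/

import Mathlib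

noncomputable section

open MeasureTheory

abbrev E3 := EuclideanSpace ℝ (Fin 3)
abbrev ST3 := ℝ × E3

def dtime (u : ST3 → ℝ) (p : ST3) : ℝ := fderiv ℝ u p (1, 0)

def dxi (i : Fin 3) (u : ST3 → ℝ) (p : ST3) : ℝ :=
  fderiv ℝ u p (0, EuclideanSpace.single i 1)

/-- The radial derivative `∂_r u = (x/r)·∇u`. -/
def radDeriv (u : ST3 → ℝ) (p : ST3) : ℝ :=
  ‖p.2‖⁻¹ * ∑ i : Fin 3, p.2 i * dxi i u p

/-- The admissible vector fields `{id, ∂_t, ∂₁, ∂₂, ∂₃, Ω₁, Ω₂, Ω₃, S}` (identity included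
so that words of a fixed length encode all shorter words). -/
def Zvf : Option (Unit ⊕ Fin 3 ⊕ Fin 3 ⊕ Unit) → (ST3 → ℝ) → ST3 → ℝ
  | none => fun u => u
  | some (Sum.inl _) => dtime
  | some (Sum.inr (Sum.inl i)) => dxi i
  | some (Sum.inr (Sum.inr (Sum.inl j))) => fun u p =>
      ![p.2 1 * dxi 2 u p - p.2 2 * dxi 1 u p,
        p.2 2 * dxi 0 u p - p.2 0 * dxi 2 u p,
        p.2 0 * dxi 1 u p - p.2 1 * dxi 0 u p] j
  | some (Sum.inr (Sum.inr (Sum.inr _))) => fun u p =>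
      p.1 * dtime u p + ∑ i : Fin 3, p.2 i * dxi i u p

/-- A word of at most three admissible vector fields applied to `u`. -/
def Zword (w : Fin 3 → Option (Unit ⊕ Fin 3 ⊕ Fin 3 ⊕ Unit)) (u : ST3 → ℝ) : ST3 → ℝ :=
  Zvf (w 0) (Zvf (w 1) (Zvf (w 2) u))

/-- The region `C^R_τ = {τ ≤ t ≤ 2τ, R < |x| < 2R, |x| ≤ t + 2}`. -/
def CRreg (τ R : ℝ) : Set ST3 :=
  {p | τ ≤ p.1 ∧ p.1 ≤ 2 * τ ∧ R < ‖p.2‖ ∧ ‖p.2‖ < 2 * R ∧ ‖p.2‖ ≤ p.1 + 2}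

/-- The enlarged region `C̃^R_τ`. -/
def CRregT (τ R : ℝ) : Set ST3 :=
  {p | 7 * τ / 8 ≤ p.1 ∧ p.1 ≤ 2 * τ ∧ 7 * R / 8 < ‖p.2‖ ∧ ‖p.2‖ < 17 * R / 8 ∧
    ‖p.2‖ ≤ p.1 + 2}


lemma ks_ftc (g g' : ℝ → ℝ) (hg : ∀ y, HasDerivAt g (g' y) y) (hg' : Continuous g')
    (a b x₀ : ℝ) (hab : a < b) (hx : x₀ ∈ Set.Icc a b) (F : ℝ → ℝ)
    (hF : ∀ y ∈ Set.Ioo a b, (g y) ^ 2 / (b - a) + 2 * |g y| * |g' y| ≤ F y) :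
    ENNReal.ofReal ((g x₀) ^ 2) ≤ ∫⁻ y in Set.Ioo a b, ENNReal.ofReal (F y) := by
  have hgc : Continuous g := continuous_iff_continuousAt.2 fun y => (hg y).continuousAt
  have hba : 0 < b - a := sub_pos.2 hab
  have hd : ∀ y, HasDerivAt (fun y => (g y) ^ 2) (2 * g y * g' y) y := by
    intro y
    have h := (hg y).fun_pow 2
    simp only [Nat.cast_ofNat, Nat.add_one_sub_one, pow_one] at h
    exact h
  have hc2 : Continuous fun y => 2 * g y * g' y := by fun_prop
  have hc3 : Continuous fun y => 2 * |g y| * |g' y| := by fun_prop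
  set L := ∫ y in a..b, 2 * |g y| * |g' y| with hL
  have key : ∀ y ∈ Set.Icc a b, (g x₀) ^ 2 ≤ (g y) ^ 2 + L := by
    intro y hy
    have h1 : ∫ z in y..x₀, 2 * g z * g' z = (g x₀) ^ 2 - (g y) ^ 2 :=
      intervalIntegral.integral_eq_sub_of_hasDerivAt (fun z _ => hd z)
        (hc2.intervalIntegrable _ _)
    have h2 : |∫ z in y..x₀, 2 * g z * g' z| ≤ |(∫ z in y..x₀, 2 * |g z| * |g' z| )| := by
      have := intervalIntegral.norm_integral_le_abs_integral_norm (f := fun z => 2 * g z * g' z)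
        (a := y) (b := x₀) (μ := volume)
      simpa [abs_mul] using this
    have h3 : |(∫ z in y..x₀, 2 * |g z| * |g' z| )| ≤ |L| := by
      refine intervalIntegral.abs_integral_mono_interval ?_ ?_ (hc3.intervalIntegrable _ _)
      · rw [Set.uIoc_of_le hab.le]
        intro z hz
        rw [Set.mem_uIoc] at hz
        constructor
        · rcases hz with h | h <;> linarith [hy.1, hx.1]
        · rcases hz with h | h <;> linarith [hy.2, hx.2]
      · exact Filter.Eventually.of_forall fun z => by positivity
    have h4 : 0 ≤ L := intervalIntegral.integral_nonneg hab.le fun z _ => by positivity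
    rw [abs_of_nonneg h4] at h3
    have := le_abs_self (∫ z in y..x₀, 2 * g z * g' z)
    linarith
  have main : (g x₀) ^ 2 ≤ ∫ y in a..b, ((g y) ^ 2 / (b - a) + 2 * |g y| * |g' y|) := by
    have h5 : ∫ y in a..b, (g x₀) ^ 2 ≤ ∫ y in a..b, ((g y) ^ 2 + L) := by
      refine intervalIntegral.integral_mono_on hab.le (by simp) ?_ key
      exact Continuous.intervalIntegrable (by fun_prop) _ _
    rw [intervalIntegral.integral_add (Continuous.intervalIntegrable (by fun_prop) _ _)
      (by simp)] at h5
    rw [intervalIntegral.integral_add (Continuous.intervalIntegrable (by fun_prop) _ _)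
      (hc3.intervalIntegrable _ _), intervalIntegral.integral_div]
    simp only [intervalIntegral.integral_const, smul_eq_mul] at h5
    rw [← hL, div_add' _ _ _ hba.ne', le_div_iff₀ hba]
    linarith
  calc ENNReal.ofReal ((g x₀) ^ 2)
      ≤ ENNReal.ofReal (∫ y in a..b, ((g y) ^ 2 / (b - a) + 2 * |g y| * |g' y|)) :=
        ENNReal.ofReal_le_ofReal main
    _ = ∫⁻ y in Set.Ioo a b, ENNReal.ofReal ((g y) ^ 2 / (b - a) + 2 * |g y| * |g' y|) := by
        rw [intervalIntegral.integral_of_le hab.le, integral_Ioc_eq_integral_Ioo]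
        apply ofReal_integral_eq_lintegral_ofReal
        · apply Continuous.integrableOn_Ioc (by fun_prop) |>.mono_set Set.Ioo_subset_Ioc_self
        · exact Filter.Eventually.of_forall fun z => by positivity
    _ ≤ _ := by
        refine setLIntegral_mono' measurableSet_Ioo fun y hy => ?_
        exact ENNReal.ofReal_le_ofReal (hF y hy)

abbrev ksL := Option (Unit ⊕ Fin 3 ⊕ Fin 3 ⊕ Unit)

def sphX (i j k : Fin 3) (r θ φ : ℝ) : E3 :=
  (r * Real.sin θ * Real.cos φ) • EuclideanSpace.single i (1 : ℝ) +
    (r * Real.sin θ * Real.sin φ) • EuclideanSpace.single j (1 : ℝ) +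
    (r * Real.cos θ) • EuclideanSpace.single k (1 : ℝ)

def goodIdx (i j k : Fin 3) : Prop := (i = 0 ∧ j = 1 ∧ k = 2) ∨ (i = 1 ∧ j = 2 ∧ k = 0)

lemma ks_dtime_smooth {u : ST3 → ℝ} (hu : ContDiff ℝ (⊤ : ℕ∞) u) :
    ContDiff ℝ (⊤ : ℕ∞) (dtime u) := by
  unfold dtime
  exact (hu.fderiv_right (m := (⊤ : ℕ∞)) (by norm_cast)).clm_apply contDiff_const

lemma ks_dxi_smooth {u : ST3 → ℝ} (hu : ContDiff ℝ (⊤ : ℕ∞) u) (i : Fin 3) :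
    ContDiff ℝ (⊤ : ℕ∞) (dxi i u) := by
  unfold dxi
  exact (hu.fderiv_right (m := (⊤ : ℕ∞)) (by norm_cast)).clm_apply contDiff_const

lemma ks_Zvf_smooth {u : ST3 → ℝ} (hu : ContDiff ℝ (⊤ : ℕ∞) u) (c : ksL) :
    ContDiff ℝ (⊤ : ℕ∞) (Zvf c u) := by
  have hco : ∀ i : Fin 3, ContDiff ℝ (⊤ : ℕ∞) fun p : ST3 => p.2 i := fun i => by
    fun_prop
  rcases c with _ | _ | i | j | _
  · exact hu
  · exact ks_dtime_smooth hu
  · exact ks_dxi_smooth hu i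
  · have h := ks_dxi_smooth hu
    fin_cases j
    · exact ((hco 1).mul (h 2)).sub ((hco 2).mul (h 1))
    · exact ((hco 2).mul (h 0)).sub ((hco 0).mul (h 2))
    · exact ((hco 0).mul (h 1)).sub ((hco 1).mul (h 0))
  · exact (contDiff_fst.mul (ks_dtime_smooth hu)).add
      (ContDiff.sum fun i _ => (hco i).mul (ks_dxi_smooth hu i))

lemma ks_fderiv_expand (u : ST3 → ℝ) (p : ST3) (s a b c : ℝ) (i j k : Fin 3) :
    fderiv ℝ u p (s, a • EuclideanSpace.single i (1 : ℝ) + b • EuclideanSpace.single j (1 : ℝ) +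
      c • EuclideanSpace.single k (1 : ℝ)) =
      s * dtime u p + (a * dxi i u p + b * dxi j u p + c * dxi k u p) := by
  have : ((s, a • EuclideanSpace.single i (1 : ℝ) + b • EuclideanSpace.single j (1 : ℝ) +
      c • EuclideanSpace.single k (1 : ℝ)) : ST3) =
      s • ((1, 0) : ST3) + a • ((0, EuclideanSpace.single i (1 : ℝ)) : ST3) +
      b • ((0, EuclideanSpace.single j (1 : ℝ)) : ST3) +
      c • ((0, EuclideanSpace.single k (1 : ℝ)) : ST3) := by
    ext <;> simp
  rw [this]
  simp only [map_add, map_smul, smul_eq_mul, dtime, dxi]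
  ring

lemma sphX_apply {i j k : Fin 3} (h : goodIdx i j k) (r θ φ : ℝ) :
    sphX i j k r θ φ i = r * Real.sin θ * Real.cos φ ∧
    sphX i j k r θ φ j = r * Real.sin θ * Real.sin φ ∧
    sphX i j k r θ φ k = r * Real.cos θ := by
  rcases h with ⟨rfl, rfl, rfl⟩ | ⟨rfl, rfl, rfl⟩ <;> simp [sphX]

lemma sphX_norm {i j k : Fin 3} (h : goodIdx i j k) (r θ φ : ℝ) (hr : 0 ≤ r) :
    ‖sphX i j k r θ φ‖ = r := by
  have h1 := sphX_apply h r θ φ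
  rw [EuclideanSpace.norm_eq]
  have h2 : ∑ l, ‖sphX i j k r θ φ l‖ ^ 2 = r ^ 2 := by
    have : ∑ l, ‖sphX i j k r θ φ l‖ ^ 2 = (sphX i j k r θ φ i) ^ 2 +
        (sphX i j k r θ φ j) ^ 2 + (sphX i j k r θ φ k) ^ 2 := by
      rcases h with ⟨rfl, rfl, rfl⟩ | ⟨rfl, rfl, rfl⟩ <;>
      simp only [Fin.sum_univ_three, Real.norm_eq_abs, sq_abs] ; ring
    rw [this, h1.1, h1.2.1, h1.2.2]
    have e1 := Real.sin_sq_add_cos_sq θ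
    have e2 := Real.sin_sq_add_cos_sq φ
    calc _ = r ^ 2 * (Real.sin θ ^ 2 * (Real.sin φ ^ 2 + Real.cos φ ^ 2) + Real.cos θ ^ 2) := by
          ring
      _ = _ := by rw [e2, mul_one, e1, mul_one]
  rw [h2, Real.sqrt_sq hr]

lemma ks_curve {u : ST3 → ℝ} (hu : ContDiff ℝ (⊤ : ℕ∞) u) (i j k : Fin 3)
    (T r θ φ : ℝ → ℝ) (T' a b c y : ℝ)
    (hT : HasDerivAt T T' y)
    (h1 : HasDerivAt (fun y => r y * Real.sin (θ y) * Real.cos (φ y)) a y)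
    (h2 : HasDerivAt (fun y => r y * Real.sin (θ y) * Real.sin (φ y)) b y)
    (h3 : HasDerivAt (fun y => r y * Real.cos (θ y)) c y) :
    HasDerivAt (fun y => u (T y, sphX i j k (r y) (θ y) (φ y)))
      (T' * dtime u (T y, sphX i j k (r y) (θ y) (φ y)) +
        (a * dxi i u (T y, sphX i j k (r y) (θ y) (φ y)) +
         b * dxi j u (T y, sphX i j k (r y) (θ y) (φ y)) +
         c * dxi k u (T y, sphX i j k (r y) (θ y) (φ y)))) y := by
  rw [← ks_fderiv_expand]
  have hd : HasFDerivAt u (fderiv ℝ u (T y, sphX i j k (r y) (θ y) (φ y)))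
      (T y, sphX i j k (r y) (θ y) (φ y)) :=
    (hu.differentiable (by simp) _).hasFDerivAt
  refine HasFDerivAt.comp_hasDerivAt (f := fun y => (T y, sphX i j k (r y) (θ y) (φ y))) y hd ?_
  refine hT.prodMk ?_
  exact ((h1.smul_const _).add (h2.smul_const _)).add (h3.smul_const _)

lemma ks_sum_idx {i j k : Fin 3} (h : goodIdx i j k) (F : Fin 3 → ℝ) :
    ∑ l, F l = F i + F j + F k := by
  rcases h with ⟨rfl, rfl, rfl⟩ | ⟨rfl, rfl, rfl⟩ <;> rw [Fin.sum_univ_three]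
  ring

def ksOm (j : Fin 3) : ksL := some (Sum.inr (Sum.inr (Sum.inl j)))

def ksS : ksL := some (Sum.inr (Sum.inr (Sum.inr ())))

lemma ks_Om {i j k : Fin 3} (h : goodIdx i j k) (u : ST3 → ℝ) (p : ST3) :
    Zvf (ksOm k) u p = p.2 i * dxi j u p - p.2 j * dxi i u p ∧
    Zvf (ksOm i) u p = p.2 j * dxi k u p - p.2 k * dxi j u p ∧
    Zvf (ksOm j) u p = p.2 k * dxi i u p - p.2 i * dxi k u p := by
  rcases h with ⟨rfl, rfl, rfl⟩ | ⟨rfl, rfl, rfl⟩ <;> simp [Zvf, ksOm]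

lemma ks_cont {f : ST3 → ℝ} (hf : Continuous f) (i j k : Fin 3) {T r θ φ : ℝ → ℝ}
    (hT : Continuous T) (hr : Continuous r) (hθ : Continuous θ) (hφ : Continuous φ) :
    Continuous fun y => f (T y, sphX i j k (r y) (θ y) (φ y)) := by
  unfold sphX
  fun_prop

lemma ks_le_sum {h : ST3 → ℝ} (c : ksL) (p : ST3) :
    (Zvf c h p) ^ 2 ≤ ∑ c : ksL, (Zvf c h p) ^ 2 :=
  Finset.single_le_sum (f := fun c : ksL => (Zvf c h p) ^ 2) (fun _ _ => sq_nonneg _)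
    (Finset.mem_univ c)

lemma ks_le_sum2 {h : ST3 → ℝ} (c d : ksL) (hcd : c ≠ d) (p : ST3) :
    (Zvf c h p) ^ 2 + (Zvf d h p) ^ 2 ≤ ∑ c : ksL, (Zvf c h p) ^ 2 := by
  have := Finset.sum_le_univ_sum_of_nonneg (s := {c, d})
    (f := fun c : ksL => (Zvf c h p) ^ 2) (fun _ => sq_nonneg _)
  rwa [Finset.sum_pair hcd] at this

lemma ks_le_sum3 {h : ST3 → ℝ} (c d : ksL) (hc : none ≠ c) (hd : none ≠ d) (hcd : c ≠ d)
    (p : ST3) :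
    (h p) ^ 2 + ((Zvf c h p) ^ 2 + (Zvf d h p) ^ 2) ≤ ∑ c : ksL, (Zvf c h p) ^ 2 := by
  have := Finset.sum_le_univ_sum_of_nonneg (s := {none, c, d})
    (f := fun c : ksL => (Zvf c h p) ^ 2) (fun _ => sq_nonneg _)
  rwa [Finset.sum_insert (by simp [hc, hd]), Finset.sum_pair hcd] at this

lemma ks_step_r {i j k : Fin 3} (hi : goodIdx i j k) {h : ST3 → ℝ}
    (hh : ContDiff ℝ (⊤ : ℕ∞) h) (R t r θ φ : ℝ) (hR : 1 ≤ R)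
    (hr : r ∈ Set.Icc (7 * R / 8) (17 * R / 8)) :
    ENNReal.ofReal ((h (t, sphX i j k r θ φ)) ^ 2) ≤
      ∫⁻ y in Set.Ioo (7 * R / 8) (17 * R / 8),
        ENNReal.ofReal ((h (t, sphX i j k y θ φ)) ^ 2 / R +
          2 * |h (t, sphX i j k y θ φ)| * |radDeriv h (t, sphX i j k y θ φ)|) := by
  have hdx := fun l => (ks_dxi_smooth hh l).continuous
  refine ks_ftc (fun y => h (t, sphX i j k y θ φ)) _ (fun y =>
    ks_curve hh i j k (fun _ => t) (fun y => y) (fun _ => θ) (fun _ => φ) 0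
      (Real.sin θ * Real.cos φ) (Real.sin θ * Real.sin φ) (Real.cos θ) y
      (hasDerivAt_const _ _) ?_ ?_ ?_) ?_ _ _ r (by linarith) hr _ ?_
  · simpa using ((hasDerivAt_id y).mul_const (Real.sin θ)).mul_const (Real.cos φ)
  · simpa using ((hasDerivAt_id y).mul_const (Real.sin θ)).mul_const (Real.sin φ)
  · simpa using ((hasDerivAt_id y).mul_const (Real.cos θ))
  · have c := fun l => ks_cont (hdx l) i j k (T := fun _ => t) (r := fun y => y)
      (θ := fun _ => θ) (φ := fun _ => φ) (by fun_prop) (by fun_prop) (by fun_prop) (by fun_prop)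
    simp only [zero_mul, zero_add]
    exact (((c i).const_mul _).add ((c j).const_mul _)).add ((c k).const_mul _)
  · intro y hy
    have hy0 : 0 < y := by linarith [hy.1]
    have e : radDeriv h (t, sphX i j k y θ φ) =
        0 * dtime h (t, sphX i j k y θ φ) +
        (Real.sin θ * Real.cos φ * dxi i h (t, sphX i j k y θ φ) +
        Real.sin θ * Real.sin φ * dxi j h (t, sphX i j k y θ φ) +
        Real.cos θ * dxi k h (t, sphX i j k y θ φ)) := by
      have a := sphX_apply hi y θ φ
      rw [radDeriv, ks_sum_idx hi]
      simp only
      rw [a.1, a.2.1, a.2.2, sphX_norm hi _ _ _ hy0.le]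
      field_simp
      ring
    rw [e]
    gcongr
    linarith

lemma ks_step_θ {i j k : Fin 3} (hi : goodIdx i j k) {h : ST3 → ℝ}
    (hh : ContDiff ℝ (⊤ : ℕ∞) h) (t r θ φ : ℝ)
    (hθ : θ ∈ Set.Icc (Real.pi / 4) (3 * Real.pi / 4)) :
    ENNReal.ofReal ((h (t, sphX i j k r θ φ)) ^ 2) ≤
      ∫⁻ y in Set.Ioo (Real.pi / 4) (3 * Real.pi / 4),
        ENNReal.ofReal (2 * ∑ c : ksL, (Zvf c h (t, sphX i j k r y φ)) ^ 2) := by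
  have hdx := fun l => (ks_dxi_smooth hh l).continuous
  have hpi := Real.pi_gt_three
  refine ks_ftc (fun y => h (t, sphX i j k r y φ)) _ (fun y =>
    ks_curve hh i j k (fun _ => t) (fun _ => r) (fun y => y) (fun _ => φ) 0
      (r * Real.cos y * Real.cos φ) (r * Real.cos y * Real.sin φ) (r * (- Real.sin y)) y
      (hasDerivAt_const _ _) ?_ ?_ ?_) ?_ _ _ θ (by linarith) hθ _ ?_
  · exact ((Real.hasDerivAt_sin y).const_mul r).mul_const (Real.cos φ)
  · exact ((Real.hasDerivAt_sin y).const_mul r).mul_const (Real.sin φ)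
  · exact ((Real.hasDerivAt_cos y).const_mul r)
  · have c := fun l => ks_cont (hdx l) i j k (T := fun _ => t) (r := fun _ => r)
      (θ := fun y => y) (φ := fun _ => φ) (by fun_prop) (by fun_prop) (by fun_prop) (by fun_prop)
    simp only [zero_mul, zero_add]
    have c1 := c i
    have c2 := c j
    have c3 := c k
    fun_prop
  · intro y hy
    have e : 0 * dtime h (t, sphX i j k r y φ) +
        (r * Real.cos y * Real.cos φ * dxi i h (t, sphX i j k r y φ) +
        r * Real.cos y * Real.sin φ * dxi j h (t, sphX i j k r y φ) +
        r * (- Real.sin y) * dxi k h (t, sphX i j k r y φ)) =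
        Real.cos φ * Zvf (ksOm j) h (t, sphX i j k r y φ) -
        Real.sin φ * Zvf (ksOm i) h (t, sphX i j k r y φ) := by
      have a := sphX_apply hi r y φ
      obtain ⟨o1, o2, o3⟩ := ks_Om hi h (t, sphX i j k r y φ)
      rw [o2, o3]
      simp only
      rw [a.1, a.2.1, a.2.2]
      have e2 := Real.sin_sq_add_cos_sq φ
      linear_combination (- r * Real.sin y * dxi k h (t, sphX i j k r y φ)) * (-1) * e2
    rw [e]
    have hne : ksOm j ≠ ksOm i := by
      rcases hi with ⟨rfl, rfl, rfl⟩ | ⟨rfl, rfl, rfl⟩ <;> simp [ksOm]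
    have b := ks_le_sum3 (h := h) (ksOm j) (ksOm i) (by simp [ksOm]) (by simp [ksOm]) hne
      (t, sphX i j k r y φ)
    set P := Zvf (ksOm j) h (t, sphX i j k r y φ)
    set Q := Zvf (ksOm i) h (t, sphX i j k r y φ)
    set H := h (t, sphX i j k r y φ)
    have e2 := Real.sin_sq_add_cos_sq φ
    have f1 : (Real.cos φ * P - Real.sin φ * Q) ^ 2 ≤ P ^ 2 + Q ^ 2 := by
      have : P ^ 2 + Q ^ 2 = (Real.cos φ * P - Real.sin φ * Q) ^ 2 +
        (Real.sin φ * P + Real.cos φ * Q) ^ 2 := by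
        linear_combination (-(P ^ 2 + Q ^ 2)) * e2
      nlinarith [sq_nonneg (Real.sin φ * P + Real.cos φ * Q)]
    have f2 : 2 * |H| * |Real.cos φ * P - Real.sin φ * Q| ≤ H ^ 2 +
        (Real.cos φ * P - Real.sin φ * Q) ^ 2 := by
      have := two_mul_le_add_sq |H| |Real.cos φ * P - Real.sin φ * Q|
      rwa [sq_abs, sq_abs] at this
    have f3 : H ^ 2 / (3 * Real.pi / 4 - Real.pi / 4) ≤ H ^ 2 :=
      div_le_self (sq_nonneg _) (by linarith)
    nlinarith [sq_nonneg P, sq_nonneg Q]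

lemma ks_step_φ {i j k : Fin 3} (hi : goodIdx i j k) {h : ST3 → ℝ}
    (hh : ContDiff ℝ (⊤ : ℕ∞) h) (t r θ φ : ℝ)
    (hφ : φ ∈ Set.Icc (-Real.pi) Real.pi) :
    ENNReal.ofReal ((h (t, sphX i j k r θ φ)) ^ 2) ≤
      ∫⁻ y in Set.Ioo (-Real.pi) Real.pi,
        ENNReal.ofReal (2 * ∑ c : ksL, (Zvf c h (t, sphX i j k r θ y)) ^ 2) := by
  have hdx := fun l => (ks_dxi_smooth hh l).continuous
  have hpi := Real.pi_gt_three
  refine ks_ftc (fun y => h (t, sphX i j k r θ y)) _ (fun y =>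
    ks_curve hh i j k (fun _ => t) (fun _ => r) (fun _ => θ) (fun y => y) 0
      (r * Real.sin θ * (-Real.sin y)) (r * Real.sin θ * Real.cos y) 0 y
      (hasDerivAt_const _ _) ?_ ?_ ?_) ?_ _ _ φ (by linarith) hφ _ ?_
  · exact ((Real.hasDerivAt_cos y).const_mul _)
  · exact ((Real.hasDerivAt_sin y).const_mul _)
  · exact hasDerivAt_const _ _
  · have c := fun l => ks_cont (hdx l) i j k (T := fun _ => t) (r := fun _ => r)
      (θ := fun _ => θ) (φ := fun y => y) (by fun_prop) (by fun_prop) (by fun_prop) (by fun_prop)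
    simp only [zero_mul, zero_add]
    have c1 := c i
    have c2 := c j
    fun_prop
  · intro y hy
    have e : 0 * dtime h (t, sphX i j k r θ y) +
        (r * Real.sin θ * (-Real.sin y) * dxi i h (t, sphX i j k r θ y) +
        r * Real.sin θ * Real.cos y * dxi j h (t, sphX i j k r θ y) +
        0 * dxi k h (t, sphX i j k r θ y)) =
        Zvf (ksOm k) h (t, sphX i j k r θ y) := by
      have a := sphX_apply hi r θ y
      obtain ⟨o1, o2, o3⟩ := ks_Om hi h (t, sphX i j k r θ y)
      rw [o1]
      simp only
      rw [a.1, a.2.1]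
      ring
    rw [e]
    have b := ks_le_sum2 (h := h) none (ksOm k) (by simp [ksOm]) (t, sphX i j k r θ y)
    have b' : Zvf none h (t, sphX i j k r θ y) = h (t, sphX i j k r θ y) := rfl
    rw [b'] at b
    set P := Zvf (ksOm k) h (t, sphX i j k r θ y)
    set H := h (t, sphX i j k r θ y)
    have f2 : 2 * |H| * |P| ≤ H ^ 2 + P ^ 2 := by
      have := two_mul_le_add_sq |H| |P|
      rwa [sq_abs, sq_abs] at this
    have f3 : H ^ 2 / (Real.pi - -Real.pi) ≤ H ^ 2 :=
      div_le_self (sq_nonneg _) (by linarith)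
    nlinarith [sq_nonneg P]

lemma ks_step_t {i j k : Fin 3} (hi : goodIdx i j k) {h : ST3 → ℝ}
    (hh : ContDiff ℝ (⊤ : ℕ∞) h) (τ t r θ φ : ℝ) (hτ : 0 < τ) (ht : τ ≤ t) :
    ENNReal.ofReal ((h (t, sphX i j k r θ φ)) ^ 2) ≤
      ∫⁻ y in Set.Ioo (15 * t / 16) t,
        ENNReal.ofReal (18 / τ * ∑ c : ksL, (Zvf c h (y, sphX i j k (r / t * y) θ φ)) ^ 2) := by
  have hdx := fun l => (ks_dxi_smooth hh l).continuous
  have hdt := (ks_dtime_smooth hh).continuous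
  have ht0 : 0 < t := by linarith
  have := ks_ftc (fun y => h (y, sphX i j k (r / t * y) θ φ)) _ (fun y =>
    ks_curve hh i j k (fun y => y) (fun y => r / t * y) (fun _ => θ) (fun _ => φ) 1
      (r / t * 1 * Real.sin θ * Real.cos φ) (r / t * 1 * Real.sin θ * Real.sin φ)
      (r / t * 1 * Real.cos θ) y
      (hasDerivAt_id _) ?_ ?_ ?_) ?_ (15 * t / 16) t t (by linarith)
      (by constructor <;> linarith) 
      (fun y => 18 / τ * ∑ c : ksL, (Zvf c h (y, sphX i j k (r / t * y) θ φ)) ^ 2) ?_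
  · simpa only [div_mul_cancel₀ r ht0.ne'] using this
  · exact (((hasDerivAt_id y).const_mul (r / t)).mul_const _).mul_const _
  · exact (((hasDerivAt_id y).const_mul (r / t)).mul_const _).mul_const _
  · exact ((hasDerivAt_id y).const_mul (r / t)).mul_const _
  · have c := fun f hf => ks_cont (f := f) hf i j k (T := fun y => y) (r := fun y => r / t * y)
      (θ := fun _ => θ) (φ := fun _ => φ) (by fun_prop) (by fun_prop) (by fun_prop) (by fun_prop)
    have c1 := c _ (hdx i)
    have c2 := c _ (hdx j)
    have c3 := c _ (hdx k)
    have c4 := c _ hdt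
    fun_prop
  · intro y hy
    have hy0 : 0 < y := by linarith [hy.1]
    set q : ST3 := (y, sphX i j k (r / t * y) θ φ) with hq
    have e : 1 * dtime h q +
        (r / t * 1 * Real.sin θ * Real.cos φ * dxi i h q +
        r / t * 1 * Real.sin θ * Real.sin φ * dxi j h q +
        r / t * 1 * Real.cos θ * dxi k h q) = Zvf ksS h q / y := by
      have a := sphX_apply hi (r / t * y) θ φ
      have : Zvf ksS h q = q.1 * dtime h q + ∑ l : Fin 3, q.2 l * dxi l h q := rfl
      rw [this, ks_sum_idx hi]
      simp only [hq]
      rw [a.1, a.2.1, a.2.2]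
      field_simp
    rw [e]
    have b := ks_le_sum2 (h := h) none ksS (by simp [ksS]) q
    have b' : Zvf none h q = h q := rfl
    rw [b'] at b
    set P := Zvf ksS h q
    set H := h q
    have f2 : 2 * |H| * |P| ≤ H ^ 2 + P ^ 2 := by
      have := two_mul_le_add_sq |H| |P|
      rwa [sq_abs, sq_abs] at this
    have f3 : H ^ 2 / (t - 15 * t / 16) ≤ 16 / τ * H ^ 2 := by
      have e1 : H ^ 2 / (t - 15 * t / 16) = 16 / t * H ^ 2 := by field_simp; ring
      rw [e1]
      gcongr
    have f4 : 2 * |H| * |P / y| ≤ 2 / τ * (H ^ 2 + P ^ 2) := by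
      have e1 : 2 * |H| * |P / y| = 1 / y * (2 * |H| * |P|) := by
        rw [abs_div, abs_of_pos hy0]; ring
      rw [e1]
      have e2 : 1 / y ≤ 2 / τ := by
        rw [div_le_div_iff₀ hy0 hτ]; linarith [hy.1]
      gcongr
    have f5 : 18 / τ * (H ^ 2 + P ^ 2) ≤ 18 / τ * ∑ c : ksL, (Zvf c h q) ^ 2 := by gcongr
    have f6 : 0 ≤ 16 / τ * P ^ 2 := by positivity
    have f7 : 18 / τ * (H ^ 2 + P ^ 2) = 16 / τ * H ^ 2 + 2 / τ * (H ^ 2 + P ^ 2) + 16 / τ * P ^ 2 := by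
      ring
    linarith

lemma sphX_meas (i j k : Fin 3) : Measurable fun q : ℝ × ℝ × ℝ => sphX i j k q.1 q.2.1 q.2.2 := by
  unfold sphX
  apply Continuous.measurable
  fun_prop

def ksM (i j k : Fin 3) (q : ℝ × ℝ × ℝ) : E3 :=
  q.2.1 • EuclideanSpace.single i (1 : ℝ) + q.2.2 • EuclideanSpace.single j (1 : ℝ) +
    q.1 • EuclideanSpace.single k (1 : ℝ)

lemma ksM_mp {i j k : Fin 3} (hi : goodIdx i j k) : MeasurePreserving (ksM i j k) := by
  have h1 := PiLp.volume_preserving_toLp (Fin 3)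
  have h2 := (volume_preserving_piFinSuccAbove (fun _ : Fin 3 => ℝ) k).symm
  have h3 := (MeasurePreserving.id (volume : Measure ℝ)).prod
    (volume_preserving_finTwoArrow ℝ).symm
  have h4 := h1.comp (h2.comp h3)
  have e : ksM i j k = (WithLp.toLp 2 ∘
      ⇑(MeasurableEquiv.piFinSuccAbove (fun x => ℝ) k).symm ∘
        Prod.map id ⇑MeasurableEquiv.finTwoArrow.symm) := by
    ext q l
    rcases hi with ⟨rfl, rfl, rfl⟩ | ⟨rfl, rfl, rfl⟩
    · fin_cases l <;> simp [ksM, MeasurableEquiv.piFinSuccAbove, MeasurableEquiv.finTwoArrow] <;> rfl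
    · fin_cases l <;> simp [ksM, MeasurableEquiv.piFinSuccAbove, MeasurableEquiv.finTwoArrow]
  rw [e]
  exact h4

lemma ks_polar (f : ℝ × ℝ → ENNReal) (hf : Measurable f) :
    ∫⁻ p, f p = ∫⁻ r in Set.Ioi (0 : ℝ), ∫⁻ φ in Set.Ioo (-Real.pi) Real.pi,
      ENNReal.ofReal r * f (r * Real.cos φ, r * Real.sin φ) := by
  rw [← lintegral_comp_polarCoord_symm]
  rw [polarCoord_target, Measure.volume_eq_prod, ← Measure.prod_restrict, lintegral_prod]
  · rfl
  · apply Measurable.aemeasurable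
    simp only [polarCoord_symm_apply, smul_eq_mul]
    fun_prop

lemma ks_polar' (f : ℝ × ℝ → ENNReal) (hf : Measurable f) :
    ∫⁻ p, f p = ∫⁻ φ in Set.Ioo (-Real.pi) Real.pi, ∫⁻ r in Set.Ioi (0 : ℝ),
      ENNReal.ofReal r * f (r * Real.cos φ, r * Real.sin φ) := by
  rw [ks_polar f hf, lintegral_lintegral_swap]
  apply Measurable.aemeasurable
  unfold Function.uncurry
  fun_prop

lemma ks_sph {i j k : Fin 3} (hi : goodIdx i j k) (F : E3 → ENNReal) (hF : Measurable F) :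
    ∫⁻ φ in Set.Ioo (-Real.pi) Real.pi, ∫⁻ θ in Set.Ioo (Real.pi / 4) (3 * Real.pi / 4),
      ∫⁻ r in Set.Ioi (0 : ℝ), ENNReal.ofReal (r ^ 2 * Real.sin θ) * F (sphX i j k r θ φ) ≤
    ∫⁻ x, F x := by
  have hMm : Measurable (ksM i j k) := (ksM_mp hi).measurable
  have hpi := Real.pi_gt_three
  rw [← (ksM_mp hi).lintegral_comp hF, Measure.volume_eq_prod, lintegral_prod _ (by fun_prop)]
  have e2 : ∀ z : ℝ, ∫⁻ p : ℝ × ℝ, F (ksM i j k (z, p)) =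
      ∫⁻ φ in Set.Ioo (-Real.pi) Real.pi, ∫⁻ r in Set.Ioi (0 : ℝ), 
      ENNReal.ofReal r * F (ksM i j k (z, r * Real.cos φ, r * Real.sin φ)) := fun z =>
    ks_polar' (fun p => F (ksM i j k (z, p))) (by fun_prop)
  have e3 : ∀ z φ : ℝ, ∫⁻ r in Set.Ioi (0 : ℝ), 
      ENNReal.ofReal r * F (ksM i j k (z, r * Real.cos φ, r * Real.sin φ)) =
      ∫⁻ r, ENNReal.ofReal r * F (ksM i j k (z, r * Real.cos φ, r * Real.sin φ)) := fun z φ => by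
    rw [← lintegral_indicator measurableSet_Ioi]
    congr 1
    ext r
    by_cases hr : 0 < r
    · rw [Set.indicator_of_mem (by exact hr)]
    · rw [Set.indicator_of_notMem (by exact hr), ENNReal.ofReal_of_nonpos (not_lt.1 hr), zero_mul]
  have hme : Measurable fun q : ℝ × ℝ × ℝ =>
      ENNReal.ofReal q.2.2 * F (ksM i j k (q.2.1, q.2.2 * Real.cos q.1, q.2.2 * Real.sin q.1)) := by
    fun_prop
  have hme2 : Measurable fun q : (ℝ × ℝ) × ℝ =>
      ENNReal.ofReal q.2 * F (ksM i j k (q.1.1, q.2 * Real.cos q.1.2, q.2 * Real.sin q.1.2)) := by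
    fun_prop
  simp_rw [e2, e3]
  have e5 := lintegral_lintegral_swap (μ := (volume : Measure ℝ))
    (ν := volume.restrict (Set.Ioo (-Real.pi) Real.pi)) (f := fun z φ => ∫⁻ r : ℝ, 
      ENNReal.ofReal r * F (ksM i j k (z, r * Real.cos φ, r * Real.sin φ))) (by
    apply Measurable.aemeasurable
    exact hme2.lintegral_prod_right')
  rw [e5]
  refine lintegral_mono fun φ => ?_
  have e4 : ∫⁻ z : ℝ, ∫⁻ r : ℝ, ENNReal.ofReal r *
      F (ksM i j k (z, r * Real.cos φ, r * Real.sin φ)) = ∫⁻ p : ℝ × ℝ, ENNReal.ofReal p.2 *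
      F (ksM i j k (p.1, p.2 * Real.cos φ, p.2 * Real.sin φ)) := by
    rw [Measure.volume_eq_prod, lintegral_prod _ (by fun_prop)]
  simp only
  rw [e4, ks_polar' _ (by fun_prop)]
  refine le_trans ?_ (lintegral_mono_set (s := Set.Ioo (Real.pi / 4) (3 * Real.pi / 4)) ?_)
  · refine lintegral_mono fun θ => ?_
    refine setLIntegral_mono' measurableSet_Ioi fun r hr => ?_
    apply le_of_eq
    rw [← mul_assoc, ← ENNReal.ofReal_mul (le_of_lt hr)]
    congr 2
    · ring
  · intro θ h
    constructor <;> linarith [h.1, h.2]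

lemma ks_cov {i j k : Fin 3} (hi : goodIdx i j k) (F : ST3 → ENNReal) (hF : Measurable F)
    (τ R : ℝ) (hR : 1 ≤ R) (hRτ : R ≤ τ / 4) :
    ∫⁻ t in Set.Ioo (7 * τ / 8) (2 * τ), ∫⁻ φ in Set.Ioo (-Real.pi) Real.pi,
      ∫⁻ θ in Set.Ioo (Real.pi / 4) (3 * Real.pi / 4),
      ∫⁻ r in Set.Ioo (7 * R / 8) (17 * R / 8), F (t, sphX i j k r θ φ) ≤
    ENNReal.ofReal (2 / R ^ 2) * ∫⁻ q in CRregT τ R, F q := by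
  have hpi := Real.pi_gt_three
  have hms : MeasurableSet {x : E3 | 7 * R / 8 < ‖x‖ ∧ ‖x‖ < 17 * R / 8} := 
    (measurableSet_lt measurable_const measurable_norm).inter
      (measurableSet_lt measurable_norm measurable_const)
  have hsub : Set.Ioo (7 * τ / 8) (2 * τ) ×ˢ {x : E3 | 7 * R / 8 < ‖x‖ ∧ ‖x‖ < 17 * R / 8} ⊆
      CRregT τ R := by
    rintro ⟨t, x⟩ ⟨h1, h2⟩
    exact ⟨h1.1.le, h1.2.le, h2.1, h2.2, by linarith [h1.1, h2.2]⟩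
  refine le_trans ?_ (mul_le_mul_right (lintegral_mono_set hsub) _)
  rw [Measure.volume_eq_prod, ← Measure.prod_restrict, lintegral_prod _ hF.aemeasurable,
    ← lintegral_const_mul' _ _ ENNReal.ofReal_ne_top]
  refine lintegral_mono fun t => ?_
  simp only
  have h1 := ks_sph hi (Set.indicator {x : E3 | 7 * R / 8 < ‖x‖ ∧ ‖x‖ < 17 * R / 8}
    (fun x => F (t, x))) ((by fun_prop : Measurable fun x => F (t, x)).indicator hms)
  rw [lintegral_indicator hms] at h1
  refine le_trans ?_ (mul_le_mul_right h1 _)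
  rw [← lintegral_const_mul' _ _ ENNReal.ofReal_ne_top]
  refine lintegral_mono fun φ => ?_
  simp only
  rw [← lintegral_const_mul' _ _ ENNReal.ofReal_ne_top]
  refine setLIntegral_mono' measurableSet_Ioo fun θ hθ => ?_
  rw [← lintegral_const_mul' _ _ ENNReal.ofReal_ne_top]
  refine le_trans ?_ (lintegral_mono_set (s := Set.Ioo (7 * R / 8) (17 * R / 8)) ?_)
  · refine setLIntegral_mono' measurableSet_Ioo fun r hr => ?_
    have hr0 : 0 < r := by linarith [hr.1]
    rw [Set.indicator_of_mem (by
      change _ < _ ∧ _ < _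
      rw [sphX_norm hi _ _ _ hr0.le]; exact hr), ← mul_assoc,
      ← ENNReal.ofReal_mul (by positivity)]
    refine le_mul_of_one_le_left zero_le ?_
    rw [ENNReal.one_le_ofReal]
    have hs : 7 / 10 ≤ Real.sin θ := by
      have h5 : Real.sqrt 2 / 2 ≤ Real.sin θ := by
        rw [← Real.cos_pi_div_four, ← Real.cos_pi_div_two_sub]
        rw [← Real.cos_abs (Real.pi / 2 - θ)]
        apply Real.cos_le_cos_of_nonneg_of_le_pi (abs_nonneg _) (by linarith)
        rw [abs_le]
        constructor <;> linarith [hθ.1, hθ.2]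
      have : (1.4 : ℝ) ≤ Real.sqrt 2 := Real.le_sqrt_of_sq_le (by norm_num)
      linarith
    have h6 : (7 * R / 8) ^ 2 * (7 / 10) ≤ r ^ 2 * Real.sin θ := by
      have := hr.1
      gcongr
    have hR2 : 0 < R ^ 2 := by positivity
    rw [div_mul_eq_mul_div, le_div_iff₀ hR2]
    nlinarith
  · intro r hr
    exact lt_trans (by positivity) hr.1

lemma ks_exists_angle {i j k : Fin 3} (hi : goodIdx i j k) (x : E3) (hx : 0 < ‖x‖)
    (h : 2 * (x k) ^ 2 ≤ ‖x‖ ^ 2) :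
    ∃ θ ∈ Set.Icc (Real.pi / 4) (3 * Real.pi / 4), ∃ φ ∈ Set.Icc (-Real.pi) Real.pi,
      x = sphX i j k ‖x‖ θ φ := by
  have hn : ‖x‖ ^ 2 = x i ^ 2 + x j ^ 2 + x k ^ 2 := by
    rw [EuclideanSpace.norm_sq_eq, ks_sum_idx hi]
    simp only [Real.norm_eq_abs, sq_abs]
  set r := ‖x‖ with hr
  set c := x k / r with hc
  have hxk : x k = r * c := by rw [hc]; field_simp
  have hc2 : c ^ 2 ≤ 1 / 2 := by
    rw [hc, div_pow, div_le_iff₀ (by positivity)]; linarith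
  have hs2 : (Real.sqrt 2 / 2) ^ 2 = 1 / 2 := by
    rw [div_pow, Real.sq_sqrt (by norm_num)]; norm_num
  have hcabs : |c| ≤ Real.sqrt 2 / 2 := by
    apply abs_le_of_sq_le_sq _ (by positivity)
    rw [hs2]; exact hc2
  have hc1 : c ≤ Real.sqrt 2 / 2 := (abs_le.1 hcabs).2
  have hc1' : -(Real.sqrt 2 / 2) ≤ c := (abs_le.1 hcabs).1
  have hpi := Real.pi_gt_three
  have harc : Real.arccos (Real.sqrt 2 / 2) = Real.pi / 4 := by
    rw [← Real.cos_pi_div_four, Real.arccos_cos (by linarith) (by linarith)]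
  refine ⟨Real.arccos c, ⟨?_, ?_⟩, Complex.arg (⟨x i, x j⟩ : ℂ),
    ⟨(Complex.neg_pi_lt_arg _).le, Complex.arg_le_pi _⟩, ?_⟩
  · rw [← harc]; exact Real.arccos_le_arccos hc1
  · have := Real.arccos_le_arccos hc1'
    rw [Real.arccos_neg, harc] at this
    linarith
  · have hlt : Real.sqrt 2 / 2 ≤ 1 := by
      nlinarith [hs2, Real.sqrt_nonneg 2]
    have hcos : Real.cos (Real.arccos c) = c := Real.cos_arccos (by linarith) (by linarith)
    have hsin : r * Real.sin (Real.arccos c) = ‖(⟨x i, x j⟩ : ℂ)‖ := by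
      rw [Real.sin_arccos]
      have h0 : 0 ≤ 1 - c ^ 2 := by linarith
      rw [← sq_eq_sq₀ (by positivity) (norm_nonneg _), mul_pow, Real.sq_sqrt h0, Complex.sq_norm,
        Complex.normSq_mk]
      rw [hxk] at hn
      linear_combination hn
    have e1 := Complex.norm_mul_cos_arg (⟨x i, x j⟩ : ℂ)
    have e2 := Complex.norm_mul_sin_arg (⟨x i, x j⟩ : ℂ)
    have a := sphX_apply hi r (Real.arccos c) (Complex.arg (⟨x i, x j⟩ : ℂ))
    rw [hsin, hcos, e1, e2, ← hxk] at a
    ext l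
    rcases hi with ⟨rfl, rfl, rfl⟩ | ⟨rfl, rfl, rfl⟩ <;> fin_cases l
    exacts [a.1.symm, a.2.1.symm, a.2.2.symm, a.2.2.symm, a.1.symm, a.2.1.symm]

lemma ks_exists_chart (x : E3) (hx : 0 < ‖x‖) :
    ∃ i j k : Fin 3, goodIdx i j k ∧
    ∃ θ ∈ Set.Icc (Real.pi / 4) (3 * Real.pi / 4), ∃ φ ∈ Set.Icc (-Real.pi) Real.pi,
      x = sphX i j k ‖x‖ θ φ := by
  have hn : ‖x‖ ^ 2 = x 0 ^ 2 + x 1 ^ 2 + x 2 ^ 2 := by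
    rw [EuclideanSpace.norm_sq_eq, Fin.sum_univ_three]
    simp only [Real.norm_eq_abs, sq_abs]
  by_cases h : 2 * (x 2) ^ 2 ≤ ‖x‖ ^ 2
  · exact ⟨0, 1, 2, Or.inl ⟨rfl, rfl, rfl⟩,
      ks_exists_angle (Or.inl ⟨rfl, rfl, rfl⟩) x hx h⟩
  · refine ⟨1, 2, 0, Or.inr ⟨rfl, rfl, rfl⟩,
      ks_exists_angle (Or.inr ⟨rfl, rfl, rfl⟩) x hx ?_⟩
    nlinarith [sq_nonneg (x 1)]

lemma ks_sum_lint {ι α : Type*} [MeasurableSpace α] (μ : Measure α) (s : Finset ι)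
    (f : ι → α → ENNReal) : ∑ a ∈ s, ∫⁻ y, f a y ∂μ ≤ ∫⁻ y, ∑ a ∈ s, f a y ∂μ := by
  classical
  induction s using Finset.induction_on with
  | empty => simp
  | insert a s ha ih =>
    simp only [Finset.sum_insert ha]
    exact (add_le_add_right ih _).trans (le_lintegral_add _ _)

lemma ks_sum_word (Φ : (ST3 → ℝ) → ENNReal) (u : ST3 → ℝ) :
    ∑ a : ksL, ∑ b : ksL, ∑ c : ksL, Φ (Zvf c (Zvf b (Zvf a u))) =
      ∑ w : Fin 3 → ksL, Φ (Zword w u) := by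
  let e : ksL × ksL × ksL ≃ (Fin 3 → ksL) :=
    { toFun := fun q => ![q.2.2, q.2.1, q.1]
      invFun := fun w => (w 2, w 1, w 0)
      left_inv := fun q => rfl
      right_inv := fun w => by ext l; fin_cases l <;> rfl }
  rw [← Equiv.sum_comp e, Fintype.sum_prod_type]
  refine Finset.sum_congr rfl fun a _ => ?_
  rw [Fintype.sum_prod_type]
  rfl

lemma ks_conv (K : ℝ) (hK : 0 ≤ K) (f : ksL → ℝ) :
    ENNReal.ofReal (K * ∑ c, (f c) ^ 2) = ENNReal.ofReal K * ∑ c, ENNReal.ofReal ((f c) ^ 2) := by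
  rw [ENNReal.ofReal_mul hK, ENNReal.ofReal_sum_of_nonneg fun _ _ => sq_nonneg _]

def ksG (R : ℝ) (h : ST3 → ℝ) (q : ST3) : ℝ := (h q) ^ 2 / R + 2 * |h q| * |radDeriv h q|

lemma ks_rad_meas {h : ST3 → ℝ} (hh : ContDiff ℝ (⊤ : ℕ∞) h) : Measurable (radDeriv h) := by
  have := fun l => (ks_dxi_smooth hh l).continuous.measurable
  unfold radDeriv
  refine Measurable.mul (by fun_prop) ?_
  refine Finset.measurable_sum _ fun l _ => ?_
  refine Measurable.mul (Continuous.measurable (by fun_prop)) (this l)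

lemma ks_Zword_smooth {u : ST3 → ℝ} (hu : ContDiff ℝ (⊤ : ℕ∞) u) (w : Fin 3 → ksL) :
    ContDiff ℝ (⊤ : ℕ∞) (Zword w u) :=
  ks_Zvf_smooth (ks_Zvf_smooth (ks_Zvf_smooth hu _) _) _

lemma ksG_meas (R : ℝ) {h : ST3 → ℝ} (hh : ContDiff ℝ (⊤ : ℕ∞) h) : Measurable (ksG R h) := by
  have h1 := ks_rad_meas hh
  have h2 := hh.continuous.measurable
  unfold ksG
  fun_prop

lemma ks_point {i j k : Fin 3} (hi : goodIdx i j k) {u : ST3 → ℝ} (hu : ContDiff ℝ (⊤ : ℕ∞) u)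
    (τ R t r θ φ : ℝ) (hR : 1 ≤ R) (hRτ : R ≤ τ / 4) (ht1 : τ ≤ t) (ht2 : t ≤ 2 * τ)
    (hr1 : R < r) (hr2 : r < 2 * R)
    (hθ : θ ∈ Set.Icc (Real.pi / 4) (3 * Real.pi / 4)) (hφ : φ ∈ Set.Icc (-Real.pi) Real.pi) :
    ENNReal.ofReal ((u (t, sphX i j k r θ φ)) ^ 2) ≤
      ENNReal.ofReal (144 / (τ * R ^ 2)) *
        ∫⁻ q in CRregT τ R, ∑ w : Fin 3 → ksL, ENNReal.ofReal (ksG R (Zword w u) q) := by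
  have hτ : 0 < τ := by linarith
  have ht0 : 0 < t := by linarith
  set E1 : ST3 → ENNReal := fun p => ∑ a : ksL, ENNReal.ofReal ((Zvf a u p) ^ 2) with hE1
  set E2 : ST3 → ENNReal := fun p =>
    ∑ a : ksL, ∑ b : ksL, ENNReal.ofReal ((Zvf b (Zvf a u) p) ^ 2) with hE2
  set E3 : ST3 → ENNReal := fun p =>
    ∑ a : ksL, ∑ b : ksL, ∑ c : ksL, ENNReal.ofReal ((Zvf c (Zvf b (Zvf a u)) p) ^ 2) with hE3
  set G : ST3 → ENNReal := fun q => ∑ w : Fin 3 → ksL, ENNReal.ofReal (ksG R (Zword w u) q)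
    with hG
  have hGm : Measurable G :=
    Finset.measurable_sum _ fun w _ => (ksG_meas R (ks_Zword_smooth hu w)).ennreal_ofReal
  have s4 : ∀ t r θ φ : ℝ, r ∈ Set.Icc (7 * R / 8) (17 * R / 8) →
      E3 (t, sphX i j k r θ φ) ≤ ∫⁻ y in Set.Ioo (7 * R / 8) (17 * R / 8),
        G (t, sphX i j k y θ φ) := by
    intro t r θ φ hr
    have e : E3 (t, sphX i j k r θ φ) =
      ∑ w : Fin 3 → ksL, ENNReal.ofReal ((Zword w u (t, sphX i j k r θ φ)) ^ 2) :=
      ks_sum_word (fun h => ENNReal.ofReal ((h (t, sphX i j k r θ φ)) ^ 2)) u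
    rw [e]
    refine le_trans ?_ (ks_sum_lint _ _ _)
    exact Finset.sum_le_sum fun w _ =>
      ks_step_r hi (ks_Zword_smooth hu w) R t r θ φ hR hr
  have s3 : ∀ t r φ : ℝ, E2 (t, sphX i j k r θ φ) ≤
      ∫⁻ y in Set.Ioo (Real.pi / 4) (3 * Real.pi / 4),
        ENNReal.ofReal 2 * E3 (t, sphX i j k r y φ) := by
    intro t r φ
    simp only [hE2, hE3, Finset.mul_sum]
    refine le_trans ?_ (ks_sum_lint _ _ _)
    refine Finset.sum_le_sum fun a _ => ?_
    refine le_trans ?_ (ks_sum_lint _ _ _)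
    refine Finset.sum_le_sum fun b _ => ?_
    have := ks_step_θ hi (ks_Zvf_smooth (ks_Zvf_smooth hu a) b) t r θ φ hθ
    simp only [ks_conv 2 (by norm_num)] at this
    simpa only [Finset.mul_sum] using this
  have s2 : ∀ t r : ℝ, E1 (t, sphX i j k r θ φ) ≤
      ∫⁻ y in Set.Ioo (-Real.pi) Real.pi,
        ENNReal.ofReal 2 * E2 (t, sphX i j k r θ y) := by
    intro t r
    simp only [hE1, hE2, Finset.mul_sum]
    refine le_trans ?_ (ks_sum_lint _ _ _)
    refine Finset.sum_le_sum fun a _ => ?_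
    have := ks_step_φ hi (ks_Zvf_smooth hu a) t r θ φ hφ
    simp only [ks_conv 2 (by norm_num)] at this
    simpa only [Finset.mul_sum] using this
  have s1 : ENNReal.ofReal ((u (t, sphX i j k r θ φ)) ^ 2) ≤
      ∫⁻ y in Set.Ioo (15 * t / 16) t,
        ENNReal.ofReal (18 / τ) * E1 (y, sphX i j k (r / t * y) θ φ) := by
    have := ks_step_t hi hu τ t r θ φ hτ ht1
    simpa only [ks_conv (18 / τ) (by positivity)] using this
  have s5 : ENNReal.ofReal ((u (t, sphX i j k r θ φ)) ^ 2) ≤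
      ∫⁻ y in Set.Ioo (15 * t / 16) t, ENNReal.ofReal (18 / τ) *
      ∫⁻ φ in Set.Ioo (-Real.pi) Real.pi, ENNReal.ofReal 2 *
      ∫⁻ θ in Set.Ioo (Real.pi / 4) (3 * Real.pi / 4), ENNReal.ofReal 2 *
      ∫⁻ r in Set.Ioo (7 * R / 8) (17 * R / 8), G (y, sphX i j k r θ φ) := by
    refine s1.trans (setLIntegral_mono' measurableSet_Ioo fun y hy => ?_)
    have hry : r / t * y ∈ Set.Icc (7 * R / 8) (17 * R / 8) := by
      rw [div_mul_eq_mul_div]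
      constructor
      · rw [le_div_iff₀ ht0]; nlinarith [hy.1]
      · rw [div_le_iff₀ ht0]; nlinarith [hy.2]
    refine mul_le_mul_right ((s2 _ _).trans (lintegral_mono fun φ => ?_)) _
    refine mul_le_mul_right ((s3 _ _ _).trans (lintegral_mono fun θ => ?_)) _
    exact mul_le_mul_right (s4 _ _ _ _ hry) _
  simp_rw [lintegral_const_mul' _ _ ENNReal.ofReal_ne_top] at s5
  have hsub : Set.Ioo (15 * t / 16) t ⊆ Set.Ioo (7 * τ / 8) (2 * τ) :=
    Set.Ioo_subset_Ioo (by linarith) ht2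
  have s6 := (lintegral_mono_set (μ := volume) (f := fun y => 
      ∫⁻ φ in Set.Ioo (-Real.pi) Real.pi,
      ∫⁻ θ in Set.Ioo (Real.pi / 4) (3 * Real.pi / 4),
      ∫⁻ r in Set.Ioo (7 * R / 8) (17 * R / 8), G (y, sphX i j k r θ φ)) hsub).trans
      (ks_cov hi G hGm τ R hR hRτ)
  refine s5.trans ?_
  calc _ ≤ ENNReal.ofReal (18 / τ) * (ENNReal.ofReal 2 * (ENNReal.ofReal 2 *
        (ENNReal.ofReal (2 / R ^ 2) * ∫⁻ q in CRregT τ R, G q))) := by gcongr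
    _ = _ := by
      rw [← mul_assoc, ← mul_assoc, ← mul_assoc, ← ENNReal.ofReal_mul (by positivity),
        ← ENNReal.ofReal_mul (by positivity), ← ENNReal.ofReal_mul (by positivity)]
      congr 2
      field_simp
      norm_num

lemma ks_intG {h : ST3 → ℝ} (hh : ContDiff ℝ (⊤ : ℕ∞) h) (τ R : ℝ) (hR : 1 ≤ R) :
    ∫⁻ q in CRregT τ R, ENNReal.ofReal (ksG R h q) ≤
      ENNReal.ofReal ((Real.sqrt (∫ q in CRregT τ R, (h q) ^ 2)) ^ 2 / R +
        2 * (Real.sqrt (∫ q in CRregT τ R, (h q) ^ 2) *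
          Real.sqrt (∫ q in CRregT τ R, (radDeriv h q) ^ 2))) := by
  set K : Set ST3 := Set.Icc (7 * τ / 8) (2 * τ) ×ˢ
    (Metric.closedBall (0 : E3) (17 * R / 8) \ Metric.ball 0 (7 * R / 8)) with hKdef
  have hK : IsCompact K :=
    isCompact_Icc.prod ((isCompact_closedBall _ _).diff Metric.isOpen_ball)
  have hsub : CRregT τ R ⊆ K := by
    rintro ⟨t, x⟩ ⟨h1, h2, h3, h4, h5⟩
    simp only [hKdef, Set.mem_prod, Set.mem_Icc, Set.mem_sdiff, Metric.mem_closedBall,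
      Metric.mem_ball, dist_zero_right, not_lt]
    exact ⟨⟨h1, h2⟩, h4.le, h3.le⟩
  have hc := hh.continuous.continuousOn (s := K)
  have hrc : ContinuousOn (radDeriv h) K := by
    unfold radDeriv
    refine ContinuousOn.mul (ContinuousOn.inv₀ (by fun_prop) ?_) ?_
    · rintro ⟨t, x⟩ hx
      simp only [hKdef, Set.mem_prod, Set.mem_Icc, Set.mem_sdiff, Metric.mem_closedBall,
        Metric.mem_ball, dist_zero_right, not_lt] at hx
      have : 0 < ‖x‖ := by linarith [hx.2.2]
      exact this.ne'
    · refine continuousOn_finsetSum _ fun l _ => ?_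
      refine ContinuousOn.mul (by fun_prop) (ks_dxi_smooth hh l).continuous.continuousOn
  have I1 : IntegrableOn (fun q => (h q) ^ 2) (CRregT τ R) :=
    ((hc.pow 2).integrableOn_compact hK).mono_set hsub
  have I2 : IntegrableOn (fun q => (radDeriv h q) ^ 2) (CRregT τ R) :=
    ((hrc.pow 2).integrableOn_compact hK).mono_set hsub
  have I3 : IntegrableOn (fun q => ‖h q‖ * ‖radDeriv h q‖) (CRregT τ R) :=
    ((hc.norm.mul hrc.norm).integrableOn_compact hK).mono_set hsub
  have M1 : MemLp h 2 (volume.restrict (CRregT τ R)) :=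
    (memLp_two_iff_integrable_sq hh.continuous.aestronglyMeasurable).2 I1
  have M2 : MemLp (radDeriv h) 2 (volume.restrict (CRregT τ R)) :=
    (memLp_two_iff_integrable_sq (ks_rad_meas hh).aestronglyMeasurable).2 I2
  have CS := integral_mul_norm_le_Lp_mul_Lq (μ := volume.restrict (CRregT τ R))
    (f := h) (g := radDeriv h) (p := 2) (q := 2) Real.HolderConjugate.two_two
    (by simpa using M1) (by simpa using M2)
  simp only [Real.rpow_two, Real.norm_eq_abs, sq_abs, ← Real.sqrt_eq_rpow] at CS
  have eG : ∀ q, ksG R h q = (h q) ^ 2 / R + 2 * (‖h q‖ * ‖radDeriv h q‖) := by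
    intro q
    simp only [ksG, Real.norm_eq_abs]; ring
  simp_rw [eG]
  rw [← ofReal_integral_eq_lintegral_ofReal]
  · apply ENNReal.ofReal_le_ofReal
    rw [integral_add (I1.div_const R) (I3.const_mul 2), integral_div, integral_const_mul,
      Real.sq_sqrt (integral_nonneg fun q => sq_nonneg _)]
    simp only [Real.norm_eq_abs]
    linarith
  · exact (I1.div_const R).add (I3.const_mul 2)
  · exact Filter.Eventually.of_forall fun q => by
      have : 0 < R := by linarith
      positivity

/-- Klainerman–Sobolev type bound on `C^R_τ` with `1 ≤ R ≤ τ/4`: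
`‖w‖_{L^∞(C^R_τ)} ≲ (τR³)^{-1/2}‖Z^{≤3}w‖ + (τ^{1/2}R)⁻¹‖Z^{≤3}w‖^{1/2}‖∂_r Z^{≤3}w‖^{1/2}`. -/
theorem ks_bound_CR :
    ∃ C > 0, ∀ τ R : ℝ, 1 ≤ R → R ≤ τ / 4 → ∀ u : ST3 → ℝ, ContDiff ℝ (⊤ : ℕ∞) u →
      ∀ p ∈ CRreg τ R,
        |u p| ≤ C * ((Real.sqrt (τ * R ^ 3))⁻¹ *
              (∑ w : Fin 3 → Option (Unit ⊕ Fin 3 ⊕ Fin 3 ⊕ Unit),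
                Real.sqrt (∫ q in CRregT τ R, (Zword w u q) ^ 2)) +
            (Real.sqrt τ * R)⁻¹ *
              Real.sqrt (∑ w : Fin 3 → Option (Unit ⊕ Fin 3 ⊕ Fin 3 ⊕ Unit),
                  Real.sqrt (∫ q in CRregT τ R, (Zword w u q) ^ 2)) *
              Real.sqrt (∑ w : Fin 3 → Option (Unit ⊕ Fin 3 ⊕ Fin 3 ⊕ Unit),
                  Real.sqrt (∫ q in CRregT τ R, (radDeriv (Zword w u) q) ^ 2))) := by
  refine ⟨17, by norm_num, ?_⟩
  rintro τ R hR hRτ u hu ⟨t, x⟩ ⟨ht1, ht2, hr1, hr2, -⟩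
  simp only at ht1 ht2 hr1 hr2
  have hτ : 0 < τ := by linarith
  have hR0 : 0 < R := by linarith
  set a : (Fin 3 → ksL) → ℝ := fun w => Real.sqrt (∫ q in CRregT τ R, (Zword w u q) ^ 2) with ha
  set b : (Fin 3 → ksL) → ℝ := fun w =>
    Real.sqrt (∫ q in CRregT τ R, (radDeriv (Zword w u) q) ^ 2) with hb
  have ha0 : ∀ w, 0 ≤ a w := fun w => Real.sqrt_nonneg _
  have hb0 : ∀ w, 0 ≤ b w := fun w => Real.sqrt_nonneg _
  have key : (u (t, x)) ^ 2 ≤ 144 / (τ * R ^ 2) * ∑ w, ((a w) ^ 2 / R + 2 * (a w * b w)) := by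
    obtain ⟨i, j, k, hi, θ, hθ, φ, hφ, hx⟩ := ks_exists_chart x (by linarith)
    have h1 := ks_point hi hu τ R t ‖x‖ θ φ hR hRτ ht1 ht2 hr1 hr2 hθ hφ
    rw [← hx, lintegral_finsetSum _ fun w _ =>
      (ksG_meas R (ks_Zword_smooth hu w)).ennreal_ofReal] at h1
    have h2 := h1.trans (mul_le_mul_right (Finset.sum_le_sum fun w _ =>
      ks_intG (ks_Zword_smooth hu w) τ R hR) _)
    rw [← ENNReal.ofReal_sum_of_nonneg (fun w _ => by positivity),
      ← ENNReal.ofReal_mul (by positivity)] at h2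
    refine (ENNReal.ofReal_le_ofReal_iff ?_).1 h2
    exact mul_nonneg (by positivity) (Finset.sum_nonneg fun w _ => by positivity)
  set A := ∑ w, a w with hA
  set B := ∑ w, b w with hB
  have hA0 : 0 ≤ A := Finset.sum_nonneg fun w _ => ha0 w
  have hB0 : 0 ≤ B := Finset.sum_nonneg fun w _ => hb0 w
  have haA : ∀ w, a w ≤ A := fun w =>
    Finset.single_le_sum (fun w _ => ha0 w) (Finset.mem_univ w)
  have h1 : ∑ w, ((a w) ^ 2 / R + 2 * (a w * b w)) ≤ A ^ 2 / R + 2 * (A * B) := by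
    rw [Finset.sum_add_distrib, ← Finset.sum_div, ← Finset.mul_sum]
    have e1 : ∑ w, (a w) ^ 2 ≤ A ^ 2 := by
      calc ∑ w, (a w) ^ 2 ≤ ∑ w, A * a w := Finset.sum_le_sum fun w _ => by
            rw [sq]; exact mul_le_mul_of_nonneg_right (haA w) (ha0 w)
        _ = A ^ 2 := by rw [← Finset.mul_sum, sq]
    have e2 : ∑ w, a w * b w ≤ A * B := by
      rw [hB, Finset.mul_sum]
      exact Finset.sum_le_sum fun w _ => mul_le_mul_of_nonneg_right (haA w) (hb0 w)
    gcongr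
  have key2 : (u (t, x)) ^ 2 ≤ 144 / (τ * R ^ 2) * (A ^ 2 / R + 2 * (A * B)) :=
    key.trans (by gcongr)
  apply abs_le_of_sq_le_sq _ (by positivity)
  set X := (Real.sqrt (τ * R ^ 3))⁻¹ * A with hX
  set Y := (Real.sqrt τ * R)⁻¹ * Real.sqrt A * Real.sqrt B with hY
  have hX0 : 0 ≤ X := by positivity
  have hY0 : 0 ≤ Y := by positivity
  have hX2 : X ^ 2 = A ^ 2 / (τ * R ^ 3) := by
    rw [hX, mul_pow, inv_pow, Real.sq_sqrt (by positivity)]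
    field_simp
  have hY2 : Y ^ 2 = A * B / (τ * R ^ 2) := by
    rw [hY, mul_pow, mul_pow, inv_pow, mul_pow, Real.sq_sqrt hτ.le, Real.sq_sqrt hA0,
      Real.sq_sqrt hB0]
    field_simp
  have e : 144 / (τ * R ^ 2) * (A ^ 2 / R + 2 * (A * B)) = 144 * X ^ 2 + 288 * Y ^ 2 := by
    rw [hX2, hY2]
    field_simp
    ring
  rw [e] at key2
  nlinarith [mul_nonneg hX0 hY0, sq_nonneg X, sq_nonneg Y]
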